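/- arXiv:1512.09264 — 3 statements merged into one kernel-verified Lean document; each statement's English description precedes it below -/
import Mathlib

section
/- Let S ⊆ ℤⁿ be a finite set of nonzero vectors such that: (i) the set of nonnegative rational combinations of elements of S is all of ℚⁿ; (ii) the negatives −e₁,…,−eₙ of the standard basis vectors belong to S; and (iii) every element of S other than −e₁,…,−eₙ has all coordinates nonnegative. If ρ ∈ S is not one of −e₁,…,−eₙ and m ∈ ℤⁿ is a Demazure root of ρ with respect to S, then m = −eᵢ for some i ∈ {1,…,n}. -/
/-- If the nonnegative rational combinations of `S` fill `ℚⁿ`, then every coordinate is positive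
on some element of `S`. -/
theorem exists_pos_coord_of_cone_eq_univ {n : ℕ} {S : Finset (Fin n → ℤ)}
    (hcone : ∀ v : Fin n → ℚ, ∃ c : (Fin n → ℤ) → ℚ,
      (∀ ρ, 0 ≤ c ρ) ∧ v = ∑ ρ ∈ S, c ρ • fun i => (ρ i : ℚ)) (j : Fin n) :
    ∃ σ ∈ S, 0 < σ j := by
  by_contra! h
  obtain ⟨c, hc, hv⟩ := hcone 1
  have hvj := congrFun hv j
  simp only [Pi.one_apply, Finset.sum_apply, Pi.smul_apply, smul_eq_mul] at hvj
  have hle : ∑ σ ∈ S, c σ * (σ j : ℚ) ≤ 0 := Finset.sum_nonpos fun σ hσ =>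
    mul_nonpos_of_nonneg_of_nonpos (hc σ) (by exact_mod_cast h σ hσ)
  linarith

/-- Let `S ⊆ ℤⁿ` be a finite set of nonzero vectors such that
(i) the nonnegative rational combinations of elements of `S` fill all of `ℚⁿ`,
(ii) the negatives `−e₁, …, −eₙ` of the standard basis vectors belong to `S`, and
(iii) every element of `S` other than `−e₁, …, −eₙ` has all coordinates nonnegative.
If `ρ ∈ S` is not one of the `−eᵢ` and `m` is a Demazure root of `ρ` with respect to `S`
(i.e. `⟨m, ρ⟩ = −1` and `⟨m, ρ'⟩ ≥ 0` for all `ρ' ∈ S` with `ρ' ≠ ρ`), then `m = −eᵢ`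
for some `i`. -/
theorem stmt2 (n : ℕ) (hn : 0 < n) (S : Finset (Fin n → ℤ))
    (hS0 : (0 : Fin n → ℤ) ∉ S)
    (hcone : ∀ v : Fin n → ℚ, ∃ c : (Fin n → ℤ) → ℚ,
      (∀ ρ, 0 ≤ c ρ) ∧ v = ∑ ρ ∈ S, c ρ • fun i => (ρ i : ℚ))
    (hbasis : ∀ i : Fin n, -(Pi.single i (1 : ℤ)) ∈ S)
    (hpos : ∀ ρ ∈ S, (∀ i : Fin n, ρ ≠ -(Pi.single i (1 : ℤ))) → ∀ j, 0 ≤ ρ j)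
    (ρ : Fin n → ℤ) (hρ : ρ ∈ S) (hρne : ∀ i : Fin n, ρ ≠ -(Pi.single i (1 : ℤ)))
    (m : Fin n → ℤ)
    (hm1 : ∑ i, m i * ρ i = -1)
    (hm2 : ∀ ρ' ∈ S, ρ' ≠ ρ → 0 ≤ ∑ i, m i * ρ' i) :
    ∃ i : Fin n, m = -(Pi.single i (1 : ℤ)) := by
  have hm : ∀ i, m i ≤ 0 := fun i => by
    have h := hm2 _ (hbasis i) (hρne i).symm
    simpa [Pi.single_apply] using h
  have hterm : ∀ σ ∈ S, (∀ i : Fin n, σ ≠ -(Pi.single i (1 : ℤ))) → ∀ i, m i * σ i ≤ 0 :=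
    fun σ hσ hne i => mul_nonpos_of_nonpos_of_nonneg (hm i) (hpos σ hσ hne i)
  have hsum_le : ∀ σ ∈ S, (∀ i : Fin n, σ ≠ -(Pi.single i (1 : ℤ))) →
      ∀ s : Finset (Fin n), ∑ i, m i * σ i ≤ ∑ i ∈ s, m i * σ i := by
    intro σ hσ hne s
    rw [← Finset.sum_add_sum_compl s]
    linarith [Finset.sum_nonpos fun i (_ : i ∈ sᶜ) => hterm σ hσ hne i]
  obtain ⟨i, -, hi⟩ := Finset.exists_ne_zero_of_sum_ne_zero (hm1.trans_ne (by norm_num))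
  have hi_neg : m i * ρ i < 0 := lt_of_le_of_ne (hterm ρ hρ hρne i) hi
  have hi_eq : m i * ρ i = -1 := by
    have h := hsum_le ρ hρ hρne {i}
    rw [hm1, Finset.sum_singleton] at h
    omega
  have hmi : m i = -1 := by
    rcases Int.isUnit_iff.mp (.of_mul_eq_one (-ρ i) (by linarith : m i * -ρ i = 1)) with h | h
    · linarith [hm i]
    · exact h
  refine ⟨i, funext fun j => ?_⟩
  by_cases hj : j = i
  · simp [hj, hmi]
  suffices m j = 0 by simp [hj, this]
  by_contra hmj
  obtain ⟨σ, hσ, hσj⟩ := exists_pos_coord_of_cone_eq_univ hcone j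
  have hσne : ∀ k : Fin n, σ ≠ -(Pi.single k (1 : ℤ)) := by
    rintro k rfl
    have : (0 : ℤ) ≤ Pi.single (M := fun _ => ℤ) k 1 j := by
      rw [Pi.single_apply]; split_ifs <;> norm_num
    simp only [Pi.neg_apply] at hσj
    linarith
  have hj_neg : m j * σ j < 0 := mul_neg_of_neg_of_pos (lt_of_le_of_ne (hm j) hmj) hσj
  by_cases hσρ : σ = ρ
  · subst hσρ
    have h := hsum_le σ hσ hσne {i, j}
    rw [hm1, Finset.sum_pair (Ne.symm hj)] at h
    linarith
  · have h := hsum_le σ hσ hσne {j}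
    rw [Finset.sum_singleton] at h
    linarith [hm2 σ hσ hσρ]
end

section
/- Let k be a field of characteristic zero and let 1 ≤ n ≤ r. For each j ∈ {1,…,n} let c_j ∈ k be nonzero and let g_j = c_j·∏_{k=n+1}^{r} x_k^{a_{jk}} with nonnegative integers a_{jk}. Let I ⊆ k[x₁,…,x_r] be the ideal generated by {x_j − g_j : 1 ≤ j ≤ n}. Then for every integer μ ≥ 1, every monomial f in x₁,…,x_r, and every h ∈ k[x₁,…,x_r], if f^N·h ∈ I^μ for some N ≥ 0 then h ∈ I^μ; that is, the saturation (I^μ : f^∞) equals I^μ. -/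
open MvPolynomial

/-- Membership in `I ^ m` can be read off from any section of evaluation at `1` that takes values in
the Rees algebra of `I`, as the `X`-adic order of the image. -/
theorem mem_pow_iff_X_pow_dvd {R : Type*} [CommRing R] {I : Ideal R}
    (ψ : R →+* Polynomial R) (hrees : ∀ p, ψ p ∈ reesAlgebra I)
    (heval : ∀ p, (ψ p).eval 1 = p) (hI : I ≤ (Ideal.span {Polynomial.X}).comap ψ)
    (m : ℕ) (p : R) : p ∈ I ^ m ↔ Polynomial.X ^ m ∣ ψ p := by
  constructor
  · intro hp
    have := Ideal.le_comap_pow ψ m (Ideal.pow_right_mono hI m hp)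
    rwa [Ideal.mem_comap, Ideal.span_singleton_pow, Ideal.mem_span_singleton] at this
  · intro hp
    rw [← heval p, Polynomial.eval_eq_sum, Polynomial.sum]
    refine Ideal.sum_mem _ fun i _ => ?_
    rw [one_pow, mul_one]
    rcases lt_or_ge i m with him | hmi
    · rw [Polynomial.X_pow_dvd_iff.mp hp i him]
      exact zero_mem _
    · exact Ideal.pow_le_pow_right hmi (mem_reesAlgebra_iff _ _ |>.mp (hrees p) i)

/-- If such a section exists over a domain, then every element whose image has nonzero constant
term is a nonzerodivisor modulo all powers of `I`. -/
theorem mem_pow_of_mul_mem_pow {R : Type*} [CommRing R] [IsDomain R] {I : Ideal R}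
    (ψ : R →+* Polynomial R) (hrees : ∀ p, ψ p ∈ reesAlgebra I)
    (heval : ∀ p, (ψ p).eval 1 = p) (hI : I ≤ (Ideal.span {Polynomial.X}).comap ψ)
    {m : ℕ} {f h : R} (hf : (ψ f).coeff 0 ≠ 0) (hfh : f * h ∈ I ^ m) : h ∈ I ^ m := by
  rw [mem_pow_iff_X_pow_dvd ψ hrees heval hI] at hfh ⊢
  rw [map_mul] at hfh
  exact Polynomial.prime_X.pow_dvd_of_dvd_mul_left m
    (fun hdvd => hf (Polynomial.X_dvd_iff.mp hdvd)) hfh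

/-- Let `k` be a field of characteristic zero, `1 ≤ n ≤ r`. For each
`j < n` let `c_j ∈ k` be nonzero and `g_j = c_j · ∏_{k ≥ n} x_k^{a_{jk}}` a term in the last
`r − n` variables. Let `I` be the ideal of `k[x₁,…,x_r]` generated by `{x_j − g_j : j < n}`.
Then for every `μ ≥ 1`, every monomial `f = x₁^{b₁}⋯x_r^{b_r}` and every polynomial `h`,
if `f^N · h ∈ I^μ` for some `N ≥ 0` then `h ∈ I^μ`; that is, the saturation
`(I^μ : f^∞)` equals `I^μ`. -/
theorem stmt6 (k : Type*) [Field k] [CharZero k] (n r : ℕ) (hn : 1 ≤ n) (hnr : n ≤ r)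
    (c : Fin r → k) (hc : ∀ j : Fin r, (j : ℕ) < n → c j ≠ 0)
    (a : Fin r → Fin r → ℕ)
    (I : Ideal (MvPolynomial (Fin r) k))
    (hI : I = Ideal.span {p | ∃ j : Fin r, (j : ℕ) < n ∧
      p = X j - C (c j) *
        ∏ k' ∈ Finset.univ.filter (fun k' : Fin r => n ≤ (k' : ℕ)), X k' ^ a j k'}) :
    ∀ μ : ℕ, 1 ≤ μ → ∀ b : Fin r → ℕ, ∀ h : MvPolynomial (Fin r) k, ∀ N : ℕ,
      (∏ j, X j ^ b j) ^ N * h ∈ I ^ μ → h ∈ I ^ μ := by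
  classical
  intro μ _ b h N hfh
  let g : Fin r → MvPolynomial (Fin r) k := fun j => C (c j) *
    ∏ k' ∈ Finset.univ.filter (fun k' : Fin r => n ≤ (k' : ℕ)), X k' ^ a j k'
  let s : Fin r → MvPolynomial (Fin r) k := fun j => if (j : ℕ) < n then g j else X j
  let ψ : MvPolynomial (Fin r) k →ₐ[k] Polynomial (MvPolynomial (Fin r) k) :=
    aeval fun j => Polynomial.C (s j) + Polynomial.C (X j - s j) * Polynomial.X
  have hψX : ∀ j, ψ (X j) = Polynomial.C (s j) + Polynomial.C (X j - s j) * Polynomial.X :=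
    fun j => aeval_X _ j
  have hψX_last : ∀ j : Fin r, n ≤ (j : ℕ) → ψ (X j) = Polynomial.C (X j) := fun j hj => by
    simp [hψX, s, not_lt.mpr hj]
  have hψC : ∀ x : k, ψ (C x) = Polynomial.C (C x) := fun x => algHom_C ψ x
  have hψg : ∀ j, ψ (g j) = Polynomial.C (g j) := fun j => by
    simp only [g, map_mul, map_prod, map_pow, hψC]
    congr 1
    refine Finset.prod_congr rfl fun i hi => ?_
    rw [hψX_last i (Finset.mem_filter.mp hi).2]
  have hmem : ∀ j, X j - s j ∈ I := fun j => by
    by_cases hj : (j : ℕ) < n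
    · rw [hI]
      exact Ideal.subset_span ⟨j, hj, by simp only [s, hj, if_true, g]⟩
    · simp [s, hj]
  have hrees : ∀ p, ψ p ∈ reesAlgebra I := fun p => by
    induction p using MvPolynomial.induction_on with
    | C x => rw [hψC]; exact (reesAlgebra I).algebraMap_mem (C x)
    | add p q hp hq => rw [map_add]; exact add_mem hp hq
    | mul_X p j hp =>
      rw [map_mul, hψX]
      refine mul_mem hp (add_mem ((reesAlgebra I).algebraMap_mem (s j)) ?_)
      rw [← pow_one Polynomial.X, Polynomial.C_mul_X_pow_eq_monomial]
      exact reesAlgebra.monomial_mem.mpr (by simpa using hmem j)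
  have heval : ∀ p, (ψ p).eval 1 = p := fun p => by
    induction p using MvPolynomial.induction_on with
    | C x => simp [hψC]
    | add p q hp hq => rw [map_add, Polynomial.eval_add, hp, hq]
    | mul_X p j hp => rw [map_mul, Polynomial.eval_mul, hp, hψX]; simp
  have hIψ : I ≤ (Ideal.span {Polynomial.X}).comap ψ.toRingHom := by
    rw [hI, Ideal.span_le]
    rintro _ ⟨j, hj, rfl⟩
    change ψ (X j - g j) ∈ Ideal.span {Polynomial.X}
    rw [map_sub, hψg, hψX, Ideal.mem_span_singleton]
    simp [s, hj]
  refine mem_pow_of_mul_mem_pow ψ.toRingHom hrees heval hIψ ?_ hfh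
  change (ψ _).coeff 0 ≠ 0
  have hs : ∀ j, s j ≠ 0 := fun j => by
    by_cases hj : (j : ℕ) < n
    · simp only [s, hj, if_true, g]
      exact mul_ne_zero (C_ne_zero.mpr (hc j hj))
        (Finset.prod_ne_zero_iff.mpr fun i _ => pow_ne_zero _ (X_ne_zero i))
    · simp [s, hj]
  rw [Polynomial.coeff_zero_eq_eval_zero, map_pow, map_prod, Polynomial.eval_pow,
    Polynomial.eval_prod]
  refine pow_ne_zero _ (Finset.prod_ne_zero_iff.mpr fun j _ => ?_)
  rw [map_pow, Polynomial.eval_pow, hψX]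
  exact pow_ne_zero _ (by simpa using hs j)
end

section
/- Let k be a field, let 1 ≤ n ≤ r, and let A be an n×(r−n) matrix of nonnegative integers. For i ∈ {1,…,n} and t ∈ k, let φ_{i,t} : kʳ → kʳ be the map which sends a point x to the point whose i-th coordinate is xᵢ + t·∏_{k=n+1}^{r} x_k^{A_{i,k−n}} and whose other coordinates are unchanged. Then for every point p ∈ kʳ all of whose coordinates are nonzero, there exist t₁,…,tₙ ∈ k, all nonzero, such that the point (φ_{1,t₁} ∘ ⋯ ∘ φ_{n,tₙ})(p) has its first n coordinates equal to 0 and its last r−n coordinates equal to those of p. -/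
/-- The map `φ_{i,t} : kʳ → kʳ` (with `kʳ` split as `k^n × k^{r−n}`, coordinates indexed by
`Fin n ⊕ Fin (r − n)`) which adds `t · ∏_{k} x_{inr k}^{A i k}` to the `i`-th of the first
`n` coordinates and leaves all other coordinates unchanged. -/
def phiMap (k : Type*) [Field k] (n r : ℕ) (A : Matrix (Fin n) (Fin (r - n)) ℕ)
    (i : Fin n) (t : k) (x : Fin n ⊕ Fin (r - n) → k) : Fin n ⊕ Fin (r - n) → k :=
  Function.update x (Sum.inl i)
    (x (Sum.inl i) + t * ∏ k' : Fin (r - n), x (Sum.inr k') ^ A i k')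

theorem foldr_phiMap_inr {k : Type*} [Field k] {n r : ℕ}
    (A : Matrix (Fin n) (Fin (r - n)) ℕ) (t : Fin n → k) (p : Fin n ⊕ Fin (r - n) → k)
    (l : List (Fin n)) (k' : Fin (r - n)) :
    ((l.map fun i => phiMap k n r A i (t i)).foldr (· ∘ ·) id) p (Sum.inr k') =
      p (Sum.inr k') := by
  induction l with
  | nil => rfl
  | cons a l ih => simpa [phiMap] using ih

theorem foldr_phiMap_inl {k : Type*} [Field k] {n r : ℕ}
    (A : Matrix (Fin n) (Fin (r - n)) ℕ) (t : Fin n → k) (p : Fin n ⊕ Fin (r - n) → k)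
    (l : List (Fin n)) (hl : l.Nodup) (i : Fin n) :
    ((l.map fun i => phiMap k n r A i (t i)).foldr (· ∘ ·) id) p (Sum.inl i) =
      if i ∈ l then p (Sum.inl i) + t i * ∏ k' : Fin (r - n), p (Sum.inr k') ^ A i k'
      else p (Sum.inl i) := by
  induction l with
  | nil => simp
  | cons a l ih =>
    obtain ⟨ha, hl⟩ := List.nodup_cons.mp hl
    have ih := ih hl
    rw [List.map_cons, List.foldr_cons, Function.comp_apply, phiMap]
    by_cases hia : i = a
    · subst hia
      simp only [Function.update_self, foldr_phiMap_inr, ih, ha, if_false, List.mem_cons_self,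
        if_true]
    · rw [Function.update_of_ne (by simpa using hia), ih]
      simp [hia]

/-- Let `k` be a field, `1 ≤ n ≤ r`, and let `A` be an `n × (r−n)` matrix
of nonnegative integers. For every point `p ∈ kʳ` with all coordinates nonzero there exist
nonzero `t₁,…,tₙ ∈ k` such that `(φ_{1,t₁} ∘ ⋯ ∘ φ_{n,tₙ})(p)` has its first `n`
coordinates equal to `0` and its last `r − n` coordinates equal to those of `p`. -/
theorem stmt11 (k : Type*) [Field k] (n r : ℕ) (hn : 1 ≤ n) (hnr : n ≤ r)
    (A : Matrix (Fin n) (Fin (r - n)) ℕ)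
    (p : Fin n ⊕ Fin (r - n) → k) (hp : ∀ j, p j ≠ 0) :
    ∃ t : Fin n → k, (∀ i, t i ≠ 0) ∧
      (∀ i : Fin n,
        ((List.ofFn fun i' : Fin n => phiMap k n r A i' (t i')).foldr (· ∘ ·) id) p
          (Sum.inl i) = 0) ∧
      (∀ k' : Fin (r - n),
        ((List.ofFn fun i' : Fin n => phiMap k n r A i' (t i')).foldr (· ∘ ·) id) p
          (Sum.inr k') = p (Sum.inr k')) := by
  have hprod (i : Fin n) : ∏ k' : Fin (r - n), p (Sum.inr k') ^ A i k' ≠ 0 :=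
    Finset.prod_ne_zero_iff.mpr fun k' _ => pow_ne_zero _ (hp _)
  refine ⟨fun i => -p (Sum.inl i) / ∏ k' : Fin (r - n), p (Sum.inr k') ^ A i k',
    fun i => div_ne_zero (neg_ne_zero.mpr (hp _)) (hprod i), fun i => ?_, fun k' => ?_⟩
  · rw [List.ofFn_eq_map, foldr_phiMap_inl A _ p _ (List.nodup_finRange n),
      if_pos (List.mem_finRange i), div_mul_cancel₀ _ (hprod i), add_neg_cancel]
  · rw [List.ofFn_eq_map, foldr_phiMap_inr]
end
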